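/- arXiv:1403.3610 — 12 statements merged into one kernel-verified Lean document; each statement's English description precedes it below -/
import Mathlib

section
/- Let L satisfy the symmetry condition with constant K, let 0 ≤ η ≤ 1 be a constant (uniform) noise rate, and assume x ↦ L(f(x), y(x)) is measurable for the classifier f. Then the noisy L-risk of f equals R_L^η(f) = (1 − 2η)·R_L(f) + K·η. -/
open MeasureTheory

/-- If the loss `L` satisfies the symmetry condition `L t 1 + L t (-1) = K`, the noise is
uniform with constant rate `η ∈ [0,1]`, and `x ↦ L (f x) (y x)` is measurable, then the noisy
`L`-risk equals `(1 - 2η) · R_L(f) + K·η`. -/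
theorem noisy_risk_eq_of_symmetric_uniform
    {X : Type*} [MeasurableSpace X] (p : Measure X) [IsProbabilityMeasure p]
    (y : X → ℝ) (hy : Measurable y) (hy1 : ∀ x, y x = 1 ∨ y x = -1)
    (L : ℝ → ℝ → ℝ) (hL : ∀ t u, 0 ≤ L t u)
    (K : ℝ) (hsym : ∀ t, L t 1 + L t (-1) = K)
    (f : X → ℝ) (hf : Measurable f)
    (hmeas : Measurable (fun x => L (f x) (y x)))
    (η : ℝ) (hη0 : 0 ≤ η) (hη1 : η ≤ 1) :
    ∫ x, ((1 - η) * L (f x) (y x) + η * L (f x) (-(y x))) ∂p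
      = (1 - 2 * η) * (∫ x, L (f x) (y x) ∂p) + K * η := by
  have hflip : ∀ x, L (f x) (y x) + L (f x) (-(y x)) = K := by
    intro x
    have h := hsym (f x)
    rcases hy1 x with hx | hx <;> rw [hx]
    · exact h
    · rw [neg_neg, add_comm]
      exact h
  have hint : Integrable (fun x => L (f x) (y x)) p := by
    refine Integrable.of_bound hmeas.aestronglyMeasurable K (ae_of_all _ fun x => ?_)
    rw [Real.norm_of_nonneg (hL _ _)]
    linarith [hflip x, hL (f x) (-(y x))]
  have hpt : ∀ x, (1 - η) * L (f x) (y x) + η * L (f x) (-(y x))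
      = (1 - 2 * η) * L (f x) (y x) + K * η := by
    intro x
    rw [← hflip x]
    ring
  simp_rw [hpt]
  rw [integral_add (hint.const_mul _) (integrable_const _), integral_const_mul]
  simp
end

section
/- (Theorem 1, uniform-noise part.) Let L satisfy the symmetry condition with constant K > 0, assume x ↦ L(f(x), y(x)) is measurable for every f ∈ F, and let the noise be uniform with constant rate η < 1/2. If f* ∈ F is a global minimizer of the noise-free L-risk R_L over F, then f* is also a global minimizer of the noisy L-risk R_L^η over F; i.e., R_L^η(f*) ≤ R_L^η(f) for all f ∈ F. -/
open MeasureTheory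

/-- Under the symmetry condition, the risk under uniform noise of rate `η` is an affine function of
the noise-free risk, with slope `1 - 2 * η`. -/
theorem integral_uniform_noise_eq
    {X : Type*} [MeasurableSpace X] (p : Measure X) [IsProbabilityMeasure p]
    {y : X → ℝ} (hy1 : ∀ x, y x = 1 ∨ y x = -1)
    {L : ℝ → ℝ → ℝ} (hL : ∀ t u, 0 ≤ L t u) {K : ℝ} (hsym : ∀ t, L t 1 + L t (-1) = K)
    {f : X → ℝ} (hmeas : Measurable (fun x => L (f x) (y x))) (η : ℝ) :
    ∫ x, ((1 - η) * L (f x) (y x) + η * L (f x) (-(y x))) ∂p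
      = (1 - 2 * η) * ∫ x, L (f x) (y x) ∂p + η * K := by
  have hflip (x : X) : L (f x) (y x) + L (f x) (-(y x)) = K := by
    rcases hy1 x with h | h <;> simp only [h, neg_neg]
    · exact hsym _
    · rw [add_comm]; exact hsym _
  have hint : Integrable (fun x => L (f x) (y x)) p := by
    refine Integrable.of_bound hmeas.aestronglyMeasurable K (.of_forall fun x => ?_)
    rw [Real.norm_of_nonneg (hL _ _)]
    linarith [hflip x, hL (f x) (-(y x))]
  calc
    _ = ∫ x, ((1 - 2 * η) * L (f x) (y x) + η * K) ∂p :=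
      integral_congr_ae (.of_forall fun x => by
        linear_combination η * hflip x)
    _ = _ := by
      rw [integral_add (hint.const_mul _) (integrable_const _), integral_const_mul]
      simp

/-- Theorem 1 (uniform noise): if `L` satisfies the symmetry condition with constant `K > 0` and
the noise is uniform with rate `η < 1/2`, then any global minimizer `f*` of the noise-free
`L`-risk over `F` is also a global minimizer of the noisy `L`-risk over `F`. -/
theorem symmetric_loss_noise_tolerant_uniform
    {X : Type*} [MeasurableSpace X] (p : Measure X) [IsProbabilityMeasure p]
    (y : X → ℝ) (hy : Measurable y) (hy1 : ∀ x, y x = 1 ∨ y x = -1)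
    (L : ℝ → ℝ → ℝ) (hL : ∀ t u, 0 ≤ L t u)
    (K : ℝ) (hK : 0 < K) (hsym : ∀ t, L t 1 + L t (-1) = K)
    (F : Set (X → ℝ)) (hF : ∀ f ∈ F, Measurable f)
    (hmeas : ∀ f ∈ F, Measurable (fun x => L (f x) (y x)))
    (η : ℝ) (hη0 : 0 ≤ η) (hη : η < 1 / 2)
    (fstar : X → ℝ) (hfstar : fstar ∈ F)
    (hmin : ∀ f ∈ F, ∫ x, L (fstar x) (y x) ∂p ≤ ∫ x, L (f x) (y x) ∂p) :
    ∀ f ∈ F,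
      ∫ x, ((1 - η) * L (fstar x) (y x) + η * L (fstar x) (-(y x))) ∂p
        ≤ ∫ x, ((1 - η) * L (f x) (y x) + η * L (f x) (-(y x))) ∂p := by
  intro f hf
  rw [integral_uniform_noise_eq p hy1 hL hsym (hmeas fstar hfstar),
    integral_uniform_noise_eq p hy1 hL hsym (hmeas f hf)]
  have hslope : 0 ≤ 1 - 2 * η := by linarith
  exact add_le_add_left (mul_le_mul_of_nonneg_left (hmin f hf) hslope) _
end

section
/- Let L satisfy the symmetry condition with constant K, let η : X → [0,1] be a measurable (non-uniform) noise-rate function, and assume x ↦ L(f(x), y(x)) is measurable for the classifier f. Then the noisy L-risk of f equals R_L^η(f) = ∫_X (1 − 2η(x))·L(f(x), y(x)) dp(x) + K·∫_X η(x) dp(x). -/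
open MeasureTheory

/-- If the loss `L` satisfies the symmetry condition `L t 1 + L t (-1) = K` and
`η : X → [0,1]` is a measurable non-uniform noise-rate function, then the noisy `L`-risk
equals `∫ (1 - 2η(x))·L(f(x), y(x)) dp + K·∫ η(x) dp`. -/
theorem noisy_risk_eq_of_symmetric_nonuniform
    {X : Type*} [MeasurableSpace X] (p : Measure X) [IsProbabilityMeasure p]
    (y : X → ℝ) (hy : Measurable y) (hy1 : ∀ x, y x = 1 ∨ y x = -1)
    (L : ℝ → ℝ → ℝ) (hL : ∀ t u, 0 ≤ L t u)
    (K : ℝ) (hsym : ∀ t, L t 1 + L t (-1) = K)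
    (η : X → ℝ) (hη : Measurable η) (hη01 : ∀ x, 0 ≤ η x ∧ η x ≤ 1)
    (f : X → ℝ) (hf : Measurable f)
    (hmeas : Measurable (fun x => L (f x) (y x))) :
    ∫ x, ((1 - η x) * L (f x) (y x) + η x * L (f x) (-(y x))) ∂p
      = (∫ x, (1 - 2 * η x) * L (f x) (y x) ∂p) + K * (∫ x, η x ∂p) := by
  have hflip : ∀ x, L (f x) (-(y x)) = K - L (f x) (y x) := by
    intro x
    have h := hsym (f x)
    rcases hy1 x with hx | hx
    · rw [hx]; linarith
    · rw [hx, neg_neg]; linarith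
  have hη_int : Integrable η p :=
    Integrable.of_bound hη.aestronglyMeasurable 1 <| .of_forall fun x => by
      rw [Real.norm_eq_abs, abs_of_nonneg (hη01 x).1]
      exact (hη01 x).2
  have hL_int : Integrable (fun x => (1 - 2 * η x) * L (f x) (y x)) p := by
    refine Integrable.of_bound
      (((hη.const_mul 2).const_sub 1).mul hmeas).aestronglyMeasurable K (.of_forall fun x => ?_)
    have hle : L (f x) (y x) ≤ K := by linarith [hflip x, hL (f x) (-(y x))]
    have habs : |1 - 2 * η x| ≤ 1 := by
      rw [abs_le]
      constructor <;> linarith [(hη01 x).1, (hη01 x).2]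
    rw [Real.norm_eq_abs, abs_mul, abs_of_nonneg (hL _ _)]
    exact (mul_le_of_le_one_left (hL _ _) habs).trans hle
  rw [← integral_const_mul, ← integral_add hL_int (hη_int.const_mul K)]
  refine integral_congr_ae (.of_forall fun x => ?_)
  simp only [hflip x]
  ring
end

section
/- (Theorem 1, non-uniform-noise part.) Let L satisfy the symmetry condition with constant K > 0, assume x ↦ L(f(x), y(x)) is measurable for every f ∈ F, and let η : X → [0,1] be a measurable noise-rate function with η(x) < 1/2 for p-almost every x. If f* ∈ F satisfies R_L(f*) = 0, then f* is a global minimizer of the noisy L-risk over F; i.e., R_L^η(f*) ≤ R_L^η(f) for all f ∈ F. -/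
open MeasureTheory

/-- If `L(t, 1) + L(t, -1) = K`, then `L(t, -u) = K - L(t, u)` for every label `u = ±1`. -/
theorem loss_neg_label_of_symmetric {L : ℝ → ℝ → ℝ} {K : ℝ}
    (hsym : ∀ t, L t 1 + L t (-1) = K) (t : ℝ) {u : ℝ} (hu : u = 1 ∨ u = -1) :
    L t (-u) = K - L t u := by
  rcases hu with rfl | rfl
  · linarith [hsym t]
  · rw [neg_neg]
    linarith [hsym t]

/-- A measurable real function with values in `[a, b]` is integrable for a finite measure. -/
theorem integrable_of_measurable_of_mem_Icc {X : Type*} [MeasurableSpace X] {p : Measure X}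
    [IsFiniteMeasure p] {g : X → ℝ} (hg : Measurable g) {a b : ℝ}
    (hab : ∀ x, g x ∈ Set.Icc a b) : Integrable g p :=
  Integrable.of_mem_Icc a b hg.aemeasurable (Filter.Eventually.of_forall hab)

/-- Theorem 1 (non-uniform noise): if `L` satisfies the symmetry condition with constant
`K > 0`, the noise rate satisfies `η(x) < 1/2` for `p`-almost every `x`, and `f* ∈ F` has zero
noise-free `L`-risk, then `f*` is a global minimizer of the noisy `L`-risk over `F`. -/
theorem symmetric_loss_noise_tolerant_nonuniform
    {X : Type*} [MeasurableSpace X] (p : Measure X) [IsProbabilityMeasure p]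
    (y : X → ℝ) (hy : Measurable y) (hy1 : ∀ x, y x = 1 ∨ y x = -1)
    (L : ℝ → ℝ → ℝ) (hL : ∀ t u, 0 ≤ L t u)
    (K : ℝ) (hK : 0 < K) (hsym : ∀ t, L t 1 + L t (-1) = K)
    (F : Set (X → ℝ)) (hF : ∀ f ∈ F, Measurable f)
    (hmeas : ∀ f ∈ F, Measurable (fun x => L (f x) (y x)))
    (η : X → ℝ) (hη : Measurable η) (hη01 : ∀ x, 0 ≤ η x ∧ η x ≤ 1)
    (hηhalf : ∀ᵐ x ∂p, η x < 1 / 2)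
    (fstar : X → ℝ) (hfstar : fstar ∈ F)
    (hzero : ∫ x, L (fstar x) (y x) ∂p = 0) :
    ∀ f ∈ F,
      ∫ x, ((1 - η x) * L (fstar x) (y x) + η x * L (fstar x) (-(y x))) ∂p
        ≤ ∫ x, ((1 - η x) * L (f x) (y x) + η x * L (f x) (-(y x))) ∂p := by
  have hneg : ∀ (f : X → ℝ) x, L (f x) (-(y x)) = K - L (f x) (y x) := fun f x =>
    loss_neg_label_of_symmetric hsym (f x) (hy1 x)
  have hle : ∀ (f : X → ℝ) x, L (f x) (y x) ≤ K := fun f x => by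
    linarith [hneg f x, hL (f x) (-(y x))]
  have hnoisy : ∀ f ∈ F, Integrable
      (fun x => (1 - η x) * L (f x) (y x) + η x * L (f x) (-(y x))) p := by
    intro f hf
    simp only [hneg]
    have hm := hmeas f hf
    refine integrable_of_measurable_of_mem_Icc (a := 0) (b := K)
      (((measurable_const.sub hη).mul hm).add (hη.mul (measurable_const.sub hm))) fun x => ?_
    obtain ⟨h0, h1⟩ := hη01 x
    have hl := hL (f x) (y x)
    have hu := hle f x
    constructor <;> nlinarith
  have hstar : (fun x => L (fstar x) (y x)) =ᵐ[p] 0 :=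
    (integral_eq_zero_iff_of_nonneg (fun x => hL _ _)
      (integrable_of_measurable_of_mem_Icc (hmeas fstar hfstar)
        fun x => ⟨hL _ _, hle fstar x⟩)).1 hzero
  intro f hf
  refine integral_mono_ae (hnoisy fstar hfstar) (hnoisy f hf) ?_
  filter_upwards [hstar, hηhalf] with x hx hηx
  simp only [Pi.zero_apply] at hx
  rw [hneg, hneg, hx]
  nlinarith [mul_nonneg (by linarith : 0 ≤ 1 - 2 * η x) (hL (f x) (y x))]
end

section
/- (Theorem 3, uniform-noise part.) Fix β > 0 and let the loss be the sigmoid loss L_sig. Let the noise be uniform with constant rate η < 1/2. If f* ∈ F is a global minimizer of the noise-free sigmoid risk R_{L_sig} over F, then f* is also a global minimizer of the noisy sigmoid risk R_{L_sig}^η over F. -/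
open MeasureTheory

/-- The sigmoid function satisfies `σ(-t) = 1 - σ(t)`. -/
theorem one_div_one_add_exp_neg (t : ℝ) :
    1 / (1 + Real.exp (-t)) = 1 - 1 / (1 + Real.exp t) := by
  rw [Real.exp_neg]
  have h : 0 < Real.exp t := Real.exp_pos t
  field_simp
  ring

theorem integrable_one_div_one_add_exp {X : Type*} [MeasurableSpace X] {p : Measure X}
    [IsFiniteMeasure p] {g : X → ℝ} (hg : Measurable g) :
    Integrable (fun x => 1 / (1 + Real.exp (g x))) p := by
  refine Integrable.of_bound (Measurable.aestronglyMeasurable (by fun_prop)) 1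
    (Filter.Eventually.of_forall fun x => ?_)
  have h : 0 < Real.exp (g x) := Real.exp_pos _
  rw [Real.norm_of_nonneg (by positivity), div_le_one (by positivity)]
  linarith

/-- The sigmoid risk under uniform label noise is an affine function of the noise-free risk. -/
theorem integral_sigmoid_loss_uniform_noise {X : Type*} [MeasurableSpace X] {p : Measure X}
    [IsProbabilityMeasure p] {f y : X → ℝ} (hf : Measurable f) (hy : Measurable y) (β η : ℝ) :
    ∫ x, ((1 - η) * (1 / (1 + Real.exp (β * f x * y x)))
        + η * (1 / (1 + Real.exp (β * f x * (-(y x)))))) ∂p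
      = (1 - 2 * η) * ∫ x, 1 / (1 + Real.exp (β * f x * y x)) ∂p + η := by
  have hint : Integrable (fun x => 1 / (1 + Real.exp (β * f x * y x))) p :=
    integrable_one_div_one_add_exp (by fun_prop)
  have hpt : ∀ x, (1 - η) * (1 / (1 + Real.exp (β * f x * y x)))
      + η * (1 / (1 + Real.exp (β * f x * (-(y x)))))
      = (1 - 2 * η) * (1 / (1 + Real.exp (β * f x * y x))) + η := fun x => by
    rw [mul_neg, one_div_one_add_exp_neg]
    ring
  simp_rw [hpt]
  rw [integral_add (hint.const_mul _) (integrable_const _), integral_const_mul]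
  simp

/-- Theorem 3 (uniform noise): for the sigmoid loss with parameter `β > 0` and uniform noise
rate `η < 1/2`, any global minimizer `f*` of the noise-free sigmoid risk over `F` is also a
global minimizer of the noisy sigmoid risk over `F`. -/
theorem sigmoid_loss_noise_tolerant_uniform
    {X : Type*} [MeasurableSpace X] (p : Measure X) [IsProbabilityMeasure p]
    (y : X → ℝ) (hy : Measurable y) (hy1 : ∀ x, y x = 1 ∨ y x = -1)
    (β : ℝ) (hβ : 0 < β)
    (F : Set (X → ℝ)) (hF : ∀ f ∈ F, Measurable f)
    (η : ℝ) (hη0 : 0 ≤ η) (hη : η < 1 / 2)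
    (fstar : X → ℝ) (hfstar : fstar ∈ F)
    (hmin : ∀ f ∈ F,
      ∫ x, 1 / (1 + Real.exp (β * fstar x * y x)) ∂p
        ≤ ∫ x, 1 / (1 + Real.exp (β * f x * y x)) ∂p) :
    ∀ f ∈ F,
      ∫ x, ((1 - η) * (1 / (1 + Real.exp (β * fstar x * y x)))
            + η * (1 / (1 + Real.exp (β * fstar x * (-(y x)))))) ∂p
        ≤ ∫ x, ((1 - η) * (1 / (1 + Real.exp (β * f x * y x)))
            + η * (1 / (1 + Real.exp (β * f x * (-(y x)))))) ∂p := by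
  intro f hf
  rw [integral_sigmoid_loss_uniform_noise (hF _ hfstar) hy,
    integral_sigmoid_loss_uniform_noise (hF f hf) hy]
  have h : 0 ≤ 1 - 2 * η := by linarith
  exact add_le_add_left (mul_le_mul_of_nonneg_left (hmin f hf) h) η
end

section
/- (Theorem 3, non-uniform-noise part.) Let η : X → [0,1] be a measurable noise-rate function with η(x) < 1/2 for p-almost every x. Let f* and f be measurable classifiers such that y(x)·f*(x) > 0 for p-almost every x (the Bayes-optimal classifier f* separates the classes), and such that the set S₁ = {x : y(x)·f(x) < 0} has p(S₁) > 0. Then there exists β_M < ∞ such that for all β ≥ β_M, the noisy sigmoid risk with parameter β of f* is strictly smaller than that of f: R_{L_sig,β}^η(f*) < R_{L_sig,β}^η(f). -/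
open MeasureTheory

open Filter Topology in
/-- The pointwise limit of the sigmoid loss of margin `a` is half the `0`-`1` loss `1 - sign a`. -/
lemma tendsto_sigmoid_loss_atTop (a : ℝ) :
    Tendsto (fun β : ℝ => 1 / (1 + Real.exp (β * a))) atTop
      (𝓝 ((1 - (SignType.sign a : ℝ)) / 2)) := by
  rcases lt_trichotomy a 0 with ha | rfl | ha
  · have h : Tendsto (fun β : ℝ => Real.exp (β * a)) atTop (𝓝 0) :=
      Real.tendsto_exp_atBot.comp (tendsto_id.atTop_mul_const_of_neg ha)
    have h2 := (tendsto_const_nhds (x := (1 : ℝ))).div (h.const_add 1) (by norm_num)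
    have h3 : (1 - (SignType.sign a : ℝ)) / 2 = 1 / (1 + 0) := by
      rw [sign_neg ha, SignType.coe_neg_one]
      norm_num
    rw [h3]
    exact h2
  · simp only [mul_zero, Real.exp_zero, sign_zero]
    norm_num
  · have h : Tendsto (fun β : ℝ => 1 + Real.exp (β * a)) atTop atTop :=
      tendsto_atTop_add_const_left _ _
        (Real.tendsto_exp_atTop.comp (tendsto_id.atTop_mul_const ha))
    simpa [sign_pos ha, Pi.inv_def] using h.inv_tendsto_atTop

lemma sigmoid_loss_nonneg (t : ℝ) : 0 ≤ 1 / (1 + Real.exp t) := by positivity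

lemma sigmoid_loss_le_one (t : ℝ) : 1 / (1 + Real.exp t) ≤ 1 := by
  rw [div_le_one (by positivity)]
  linarith [Real.exp_pos t]

lemma measurable_coe_sign {X : Type*} [MeasurableSpace X] {g : X → ℝ} (hg : Measurable g) :
    Measurable fun x => (SignType.sign (g x) : ℝ) := by
  have h : (fun x => (SignType.sign (g x) : ℝ)) =
      fun x => if 0 < g x then 1 else if g x < 0 then -1 else 0 := by
    ext x
    rw [sign_apply]
    split_ifs <;> simp
  rw [h]
  exact Measurable.ite (measurableSet_lt measurable_const hg) measurable_const
    (Measurable.ite (measurableSet_lt hg measurable_const) measurable_const measurable_const)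

lemma abs_coe_sign_le_one (a : ℝ) : |(SignType.sign a : ℝ)| ≤ 1 := by
  rcases lt_trichotomy a 0 with ha | rfl | ha <;> simp [*, sign_neg, sign_pos]

open Filter Topology in
/-- The noisy sigmoid risk converges to the noisy `0`-`1` risk (ties counting one half). -/
lemma tendsto_noisy_sigmoid_risk {X : Type*} [MeasurableSpace X] (p : Measure X)
    [IsFiniteMeasure p] {y η f : X → ℝ} (hy : Measurable y) (hη : Measurable η)
    (hη01 : ∀ x, 0 ≤ η x ∧ η x ≤ 1) (hf : Measurable f) :
    Tendsto (fun β : ℝ => ∫ x, ((1 - η x) * (1 / (1 + Real.exp (β * f x * y x)))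
            + η x * (1 / (1 + Real.exp (β * f x * (-(y x)))))) ∂p) atTop
      (𝓝 (∫ x, (1 - (1 - 2 * η x) * (SignType.sign (f x * y x) : ℝ)) / 2 ∂p)) := by
  refine tendsto_integral_filter_of_dominated_convergence (fun _ => 1) ?_ ?_
    (integrable_const _) ?_
  · exact Eventually.of_forall fun β => Measurable.aestronglyMeasurable (by fun_prop)
  · refine Eventually.of_forall fun β => Eventually.of_forall fun x => ?_
    obtain ⟨h0, h1⟩ := hη01 x
    have a0 := sigmoid_loss_nonneg (β * f x * y x)
    have a1 := sigmoid_loss_le_one (β * f x * y x)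
    have b0 := sigmoid_loss_nonneg (β * f x * -(y x))
    have b1 := sigmoid_loss_le_one (β * f x * -(y x))
    rw [Real.norm_eq_abs, abs_le]
    constructor <;> nlinarith [mul_nonneg (sub_nonneg.2 h1) a0, mul_nonneg h0 b0]
  · refine Eventually.of_forall fun x => ?_
    have h := ((tendsto_sigmoid_loss_atTop (f x * y x)).const_mul (1 - η x)).add
      ((tendsto_sigmoid_loss_atTop (f x * -(y x))).const_mul (η x))
    simp only [← mul_assoc] at h
    convert h using 2
    rw [mul_neg, Left.sign_neg, SignType.coe_neg]
    ring

lemma integrable_noisy_sign_loss {X : Type*} [MeasurableSpace X] (p : Measure X)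
    [IsFiniteMeasure p] {y η f : X → ℝ} (hy : Measurable y) (hη : Measurable η)
    (hη01 : ∀ x, 0 ≤ η x ∧ η x ≤ 1) (hf : Measurable f) :
    Integrable (fun x => (1 - (1 - 2 * η x) * (SignType.sign (f x * y x) : ℝ)) / 2) p := by
  have hs := measurable_coe_sign (hf.mul hy)
  simp only [Pi.mul_apply] at hs
  refine Integrable.of_bound (Measurable.aestronglyMeasurable (by fun_prop)) 1
    (Filter.Eventually.of_forall fun x => ?_)
  obtain ⟨h0, h1⟩ := hη01 x
  obtain ⟨s0, s1⟩ := abs_le.1 (abs_coe_sign_le_one (f x * y x))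
  rw [Real.norm_eq_abs, abs_le]
  constructor <;> nlinarith

/-- Theorem 3 (non-uniform noise): if `η(x) < 1/2` a.e., `f*` separates the classes
(`y(x)·f*(x) > 0` a.e.) and `f` misclassifies a set of positive probability, then there is a
finite `β_M` such that for all `β ≥ β_M` the noisy sigmoid risk of `f*` is strictly smaller
than that of `f`. -/
theorem sigmoid_loss_noise_tolerant_nonuniform
    {X : Type*} [MeasurableSpace X] (p : Measure X) [IsProbabilityMeasure p]
    (y : X → ℝ) (hy : Measurable y) (hy1 : ∀ x, y x = 1 ∨ y x = -1)
    (η : X → ℝ) (hη : Measurable η) (hη01 : ∀ x, 0 ≤ η x ∧ η x ≤ 1)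
    (hηhalf : ∀ᵐ x ∂p, η x < 1 / 2)
    (fstar f : X → ℝ) (hfstar : Measurable fstar) (hf : Measurable f)
    (hsep : ∀ᵐ x ∂p, 0 < y x * fstar x)
    (hS1 : 0 < p {x | y x * f x < 0}) :
    ∃ βM : ℝ, ∀ β ≥ βM,
      ∫ x, ((1 - η x) * (1 / (1 + Real.exp (β * fstar x * y x)))
            + η x * (1 / (1 + Real.exp (β * fstar x * (-(y x)))))) ∂p
        < ∫ x, ((1 - η x) * (1 / (1 + Real.exp (β * f x * y x)))
            + η x * (1 / (1 + Real.exp (β * f x * (-(y x)))))) ∂p := by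
  have hlim : ∫ x, (1 - (1 - 2 * η x) * (SignType.sign (fstar x * y x) : ℝ)) / 2 ∂p
      < ∫ x, (1 - (1 - 2 * η x) * (SignType.sign (f x * y x) : ℝ)) / 2 ∂p := by
    have hi := integrable_noisy_sign_loss p hy hη hη01 hfstar
    have hi' := integrable_noisy_sign_loss p hy hη hη01 hf
    rw [← sub_pos, ← integral_sub hi' hi]
    refine (integral_pos_iff_support_of_nonneg_ae ?_ (hi'.sub hi)).2 ?_
    · filter_upwards [hηhalf, hsep] with x h1 h2
      have h4 := (abs_le.1 (abs_coe_sign_le_one (f x * y x))).2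
      rw [mul_comm] at h2
      simp only [sign_pos h2, SignType.coe_one, Pi.zero_apply, Pi.sub_apply]
      nlinarith
    · refine hS1.trans_le (measure_mono_ae ?_)
      filter_upwards [hηhalf, hsep] with x h1 h2 (h3 : y x * f x < 0)
      change (1 - (1 - 2 * η x) * (SignType.sign (f x * y x) : ℝ)) / 2
        - (1 - (1 - 2 * η x) * (SignType.sign (fstar x * y x) : ℝ)) / 2 ≠ 0
      rw [mul_comm] at h2 h3
      simp only [sign_pos h2, sign_neg h3, SignType.coe_neg_one, SignType.coe_one]
      exact ne_of_gt (by linarith)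
  exact Filter.eventually_atTop.1 ((tendsto_noisy_sigmoid_risk p hy hη hη01 hfstar).eventually_lt
    (tendsto_noisy_sigmoid_risk p hy hη hη01 hf) hlim)
end

section
/- (Theorem 4, uniform-noise part.) Fix β > 0 and let the loss be the ramp loss L_ramp. Let the noise be uniform with constant rate η < 1/2. If f* ∈ F is a global minimizer of the noise-free ramp risk R_{L_ramp} over F, then f* is also a global minimizer of the noisy ramp risk R_{L_ramp}^η over F. -/
open MeasureTheory

/-- The ramp losses at the margins `s` and `-s` add up to `2`. -/
theorem ramp_add_ramp_neg (s : ℝ) :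
    (max 0 (1 - s) - max 0 (-1 - s)) + (max 0 (1 - -s) - max 0 (-1 - -s)) = 2 := by
  grind

theorem abs_ramp_le_two (s : ℝ) : |max 0 (1 - s) - max 0 (-1 - s)| ≤ 2 := by
  rw [abs_le]
  constructor <;> grind

theorem integrable_ramp {X : Type*} [MeasurableSpace X] (p : Measure X) [IsFiniteMeasure p]
    {s : X → ℝ} (hs : Measurable s) :
    Integrable (fun x => max 0 (1 - s x) - max 0 (-1 - s x)) p :=
  Integrable.of_bound (C := 2) (by fun_prop) (ae_of_all _ fun x => abs_ramp_le_two (s x))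

/-- Under uniform noise, the noisy ramp risk is an affine function of the noise-free one. -/
theorem integral_noisy_ramp {X : Type*} [MeasurableSpace X] (p : Measure X)
    [IsProbabilityMeasure p] {f y : X → ℝ} (hf : Measurable f) (hy : Measurable y) (β η : ℝ) :
    ∫ x, ((1 - η) * (max 0 (1 - β * f x * y x) - max 0 (-1 - β * f x * y x))
        + η * (max 0 (1 - β * f x * (-(y x))) - max 0 (-1 - β * f x * (-(y x))))) ∂p
      = (1 - 2 * η) * ∫ x, (max 0 (1 - β * f x * y x) - max 0 (-1 - β * f x * y x)) ∂p
        + 2 * η := by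
  have hint := integrable_ramp p (s := fun x => β * f x * y x) (by fun_prop)
  calc
    _ = ∫ x, ((1 - 2 * η) * (max 0 (1 - β * f x * y x) - max 0 (-1 - β * f x * y x))
          + 2 * η) ∂p := by
      congr 1 with x
      rw [mul_neg]
      linear_combination η * ramp_add_ramp_neg (β * f x * y x)
    _ = _ := by
      rw [integral_add (hint.const_mul _) (integrable_const _), integral_const_mul]
      simp

/-- Theorem 4 (uniform noise): for the ramp loss with parameter `β > 0` and uniform noise rate
`η < 1/2`, any global minimizer `f*` of the noise-free ramp risk over `F` is also a global
minimizer of the noisy ramp risk over `F`. -/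
theorem ramp_loss_noise_tolerant_uniform
    {X : Type*} [MeasurableSpace X] (p : Measure X) [IsProbabilityMeasure p]
    (y : X → ℝ) (hy : Measurable y) (hy1 : ∀ x, y x = 1 ∨ y x = -1)
    (β : ℝ) (hβ : 0 < β)
    (F : Set (X → ℝ)) (hF : ∀ f ∈ F, Measurable f)
    (η : ℝ) (hη0 : 0 ≤ η) (hη : η < 1 / 2)
    (fstar : X → ℝ) (hfstar : fstar ∈ F)
    (hmin : ∀ f ∈ F,
      ∫ x, (max 0 (1 - β * fstar x * y x) - max 0 (-1 - β * fstar x * y x)) ∂p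
        ≤ ∫ x, (max 0 (1 - β * f x * y x) - max 0 (-1 - β * f x * y x)) ∂p) :
    ∀ f ∈ F,
      ∫ x, ((1 - η) * (max 0 (1 - β * fstar x * y x) - max 0 (-1 - β * fstar x * y x))
            + η * (max 0 (1 - β * fstar x * (-(y x))) - max 0 (-1 - β * fstar x * (-(y x))))) ∂p
        ≤ ∫ x, ((1 - η) * (max 0 (1 - β * f x * y x) - max 0 (-1 - β * f x * y x))
            + η * (max 0 (1 - β * f x * (-(y x))) - max 0 (-1 - β * f x * (-(y x))))) ∂p := by
  intro f hf
  rw [integral_noisy_ramp p (hF _ hfstar) hy, integral_noisy_ramp p (hF f hf) hy]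
  have hη' : 0 ≤ 1 - 2 * η := by linarith
  exact add_le_add_left (mul_le_mul_of_nonneg_left (hmin f hf) hη') _
end

section
/- (Theorem 4, non-uniform-noise part.) Let η : X → [0,1] be a measurable noise-rate function with η(x) < 1/2 for p-almost every x. Let f* and f be measurable classifiers such that y(x)·f*(x) > 0 for p-almost every x, and such that the set S₁ = {x : y(x)·f(x) < 0} has p(S₁) > 0. Then there exists β_M < ∞ such that for all β ≥ β_M, the noisy ramp risk with parameter β of f* is strictly smaller than that of f: R_{L_ramp,β}^η(f*) < R_{L_ramp,β}^η(f). -/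
open MeasureTheory

open Filter Topology

/-- The ramp loss as a function of the margin. -/
def ramp (u : ℝ) : ℝ := max 0 (1 - u) - max 0 (-1 - u)

/-- The pointwise limit of `β ↦ ramp (β * v)` as `β → ∞`. -/
noncomputable def rampLimit (v : ℝ) : ℝ := if v < 0 then 2 else if v = 0 then 1 else 0

lemma ramp_nonneg (u : ℝ) : 0 ≤ ramp u :=
  sub_nonneg.2 (max_le_max le_rfl (by linarith))

lemma ramp_neg (u : ℝ) : ramp (-u) = 2 - ramp u := by
  unfold ramp
  rcases max_cases 0 (1 - u) with h | h <;> rcases max_cases 0 (-1 - u) with h' | h' <;>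
    rcases max_cases 0 (1 - -u) with k | k <;> rcases max_cases 0 (-1 - -u) with k' | k' <;>
    linarith

lemma ramp_le_two (u : ℝ) : ramp u ≤ 2 := by
  linarith [ramp_neg u, ramp_nonneg (-u)]

lemma ramp_eq_zero {u : ℝ} (hu : 1 ≤ u) : ramp u = 0 := by
  rw [ramp, max_eq_left (by linarith), max_eq_left (by linarith), sub_self]

lemma ramp_eq_two {u : ℝ} (hu : u ≤ -1) : ramp u = 2 := by
  linarith [ramp_neg u, ramp_eq_zero (u := -u) (by linarith)]

@[fun_prop]
lemma measurable_ramp : Measurable ramp := by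
  unfold ramp
  fun_prop

lemma measurable_rampLimit : Measurable rampLimit :=
  Measurable.ite measurableSet_Iio measurable_const
    (Measurable.ite (measurableSet_singleton 0) measurable_const measurable_const)

lemma rampLimit_nonneg (v : ℝ) : 0 ≤ rampLimit v := by
  unfold rampLimit
  split_ifs <;> norm_num

lemma rampLimit_le_two (v : ℝ) : rampLimit v ≤ 2 := by
  unfold rampLimit
  split_ifs <;> norm_num

lemma tendsto_ramp_mul (v : ℝ) :
    Tendsto (fun β : ℝ => ramp (β * v)) atTop (𝓝 (rampLimit v)) := by
  rcases lt_trichotomy v 0 with hv | rfl | hv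
  · rw [rampLimit, if_pos hv]
    refine tendsto_const_nhds.congr' ?_
    filter_upwards [(tendsto_id.atTop_mul_const_of_neg hv).eventually_le_atBot (-1)] with β hβ
    exact (ramp_eq_two hβ).symm
  · simp [rampLimit, ramp]
  · rw [rampLimit, if_neg hv.not_gt, if_neg hv.ne']
    refine tendsto_const_nhds.congr' ?_
    filter_upwards [(tendsto_id.atTop_mul_const hv).eventually_ge_atTop 1] with β hβ
    exact (ramp_eq_zero hβ).symm

lemma noisy_ramp_eq (e β t u : ℝ) :
    (1 - e) * (max 0 (1 - β * t * u) - max 0 (-1 - β * t * u))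
      + e * (max 0 (1 - β * t * (-u)) - max 0 (-1 - β * t * (-u)))
      = 2 * e + (1 - 2 * e) * ramp (β * (u * t)) := by
  change (1 - e) * ramp (β * t * u) + e * ramp (β * t * (-u)) = _
  rw [mul_neg, ramp_neg, show β * t * u = β * (u * t) by ring]
  ring

lemma abs_noisy_le {e r : ℝ} (he : 0 ≤ e ∧ e ≤ 1) (hr : 0 ≤ r) (hr2 : r ≤ 2) :
    |2 * e + (1 - 2 * e) * r| ≤ 2 := by
  rw [abs_le]
  constructor <;> nlinarith [mul_nonneg he.1 (sub_nonneg.2 hr2), mul_nonneg (sub_nonneg.2 he.2) hr,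
    mul_nonneg he.1 hr, mul_nonneg (sub_nonneg.2 he.2) (sub_nonneg.2 hr2)]

section

variable {X : Type*} [MeasurableSpace X] {p : Measure X} [IsProbabilityMeasure p]
  {η v : X → ℝ}

lemma integrable_noisy_rampLimit (hη : Measurable η) (hη01 : ∀ x, 0 ≤ η x ∧ η x ≤ 1)
    (hv : Measurable v) :
    Integrable (fun x => 2 * η x + (1 - 2 * η x) * rampLimit (v x)) p := by
  have hm : Measurable fun x => rampLimit (v x) := measurable_rampLimit.comp hv
  exact Integrable.of_bound (by fun_prop) 2 (.of_forall fun x =>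
    abs_noisy_le (hη01 x) (rampLimit_nonneg _) (rampLimit_le_two _))

/-- As the scale of the ramp loss grows, its noisy risk converges to the risk of the limit loss. -/
lemma tendsto_integral_noisy_ramp (hη : Measurable η) (hη01 : ∀ x, 0 ≤ η x ∧ η x ≤ 1)
    (hv : Measurable v) :
    Tendsto (fun β : ℝ => ∫ x, (2 * η x + (1 - 2 * η x) * ramp (β * v x)) ∂p) atTop
      (𝓝 (∫ x, (2 * η x + (1 - 2 * η x) * rampLimit (v x)) ∂p)) := by
  refine tendsto_integral_filter_of_dominated_convergence (fun _ => 2)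
    (.of_forall fun β => by fun_prop) (.of_forall fun β => .of_forall fun x =>
      abs_noisy_le (hη01 x) (ramp_nonneg _) (ramp_le_two _)) (integrable_const _)
    (.of_forall fun x => ?_)
  exact ((tendsto_ramp_mul (v x)).const_mul _).const_add _

end

/-- Theorem 4 (non-uniform noise): if `η(x) < 1/2` a.e., `f*` separates the classes
(`y(x)·f*(x) > 0` a.e.) and `f` misclassifies a set of positive probability, then there is a
finite `β_M` such that for all `β ≥ β_M` the noisy ramp risk of `f*` is strictly smaller than
that of `f`. -/
theorem ramp_loss_noise_tolerant_nonuniform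
    {X : Type*} [MeasurableSpace X] (p : Measure X) [IsProbabilityMeasure p]
    (y : X → ℝ) (hy : Measurable y) (hy1 : ∀ x, y x = 1 ∨ y x = -1)
    (η : X → ℝ) (hη : Measurable η) (hη01 : ∀ x, 0 ≤ η x ∧ η x ≤ 1)
    (hηhalf : ∀ᵐ x ∂p, η x < 1 / 2)
    (fstar f : X → ℝ) (hfstar : Measurable fstar) (hf : Measurable f)
    (hsep : ∀ᵐ x ∂p, 0 < y x * fstar x)
    (hS1 : 0 < p {x | y x * f x < 0}) :
    ∃ βM : ℝ, ∀ β ≥ βM,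
      ∫ x, ((1 - η x) * (max 0 (1 - β * fstar x * y x) - max 0 (-1 - β * fstar x * y x))
            + η x * (max 0 (1 - β * fstar x * (-(y x)))
                      - max 0 (-1 - β * fstar x * (-(y x))))) ∂p
        < ∫ x, ((1 - η x) * (max 0 (1 - β * f x * y x) - max 0 (-1 - β * f x * y x))
            + η x * (max 0 (1 - β * f x * (-(y x)))
                      - max 0 (-1 - β * f x * (-(y x))))) ∂p := by
  have hv : Measurable fun x => y x * f x := hy.mul hf
  have hvs : Measurable fun x => y x * fstar x := hy.mul hfstar
  simp only [noisy_ramp_eq]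
  refine eventually_atTop.1 ((tendsto_integral_noisy_ramp hη hη01 hvs).eventually_lt
    (tendsto_integral_noisy_ramp hη hη01 hv) ?_)
  have hi := integrable_noisy_rampLimit (p := p) hη hη01 hv
  have his := integrable_noisy_rampLimit (p := p) hη hη01 hvs
  rw [← sub_pos, ← integral_sub hi his]
  have hae : ∀ᵐ x ∂p, 2 * η x + (1 - 2 * η x) * rampLimit (y x * f x)
      - (2 * η x + (1 - 2 * η x) * rampLimit (y x * fstar x))
      = (1 - 2 * η x) * rampLimit (y x * f x) := by
    filter_upwards [hsep] with x hx
    have : rampLimit (y x * fstar x) = 0 := by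
      rw [rampLimit, if_neg hx.not_gt, if_neg hx.ne']
    rw [this]
    ring
  rw [integral_congr_ae hae, integral_pos_iff_support_of_nonneg_ae ?_ ((hi.sub his).congr hae)]
  · refine hS1.trans_le (measure_mono_ae ?_)
    filter_upwards [hηhalf] with x hx (hx' : y x * f x < 0)
    refine mul_ne_zero (by linarith) ?_
    rw [rampLimit, if_pos hx']
    exact two_ne_zero
  · filter_upwards [hηhalf] with x hx
    exact mul_nonneg (by linarith) (rampLimit_nonneg _)
end

section
/- (Theorem 5, uniform-noise part.) Fix β > 0 and let the loss be the probit loss L_probit. Let the noise be uniform with constant rate η < 1/2. If f* ∈ F is a global minimizer of the noise-free probit risk R_{L_probit} over F, then f* is also a global minimizer of the noisy probit risk R_{L_probit}^η over F. -/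
open MeasureTheory ProbabilityTheory

/-- A centred Gaussian distribution function `Φ` satisfies `Φ (-z) = 1 - Φ z`. -/
lemma gaussianReal_zero_real_Iic_neg {v : NNReal} (hv : v ≠ 0) (z : ℝ) :
    (gaussianReal 0 v).real (Set.Iic (-z)) = 1 - (gaussianReal 0 v).real (Set.Iic z) := by
  have := nullSingletonClass_gaussianReal (μ := 0) hv
  have hmap : (gaussianReal 0 v).map (fun x ↦ -x) = gaussianReal 0 v := by
    simpa using gaussianReal_map_neg (μ := 0) (v := v)
  have hpre : (fun x : ℝ ↦ -x) ⁻¹' Set.Iic (-z) = Set.Ici z := by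
    ext x
    simp
  rw [← probReal_compl_eq_one_sub measurableSet_Iic, Set.compl_Iic,
    measureReal_congr Ioi_ae_eq_Ici]
  conv_lhs => rw [← hmap]
  rw [map_measureReal_apply measurable_neg measurableSet_Iic, hpre]

/-- Theorem 5 (uniform noise): for the probit loss with parameter `β > 0` (where `Φ` is the
standard normal CDF) and uniform noise rate `η < 1/2`, any global minimizer `f*` of the
noise-free probit risk over `F` is also a global minimizer of the noisy probit risk over `F`. -/
theorem probit_loss_noise_tolerant_uniform
    {X : Type*} [MeasurableSpace X] (p : Measure X) [IsProbabilityMeasure p]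
    (y : X → ℝ) (hy : Measurable y) (hy1 : ∀ x, y x = 1 ∨ y x = -1)
    (β : ℝ) (hβ : 0 < β)
    (Φ : ℝ → ℝ) (hΦ : ∀ z, Φ z = (gaussianReal 0 1 (Set.Iic z)).toReal)
    (F : Set (X → ℝ)) (hF : ∀ f ∈ F, Measurable f)
    (η : ℝ) (hη0 : 0 ≤ η) (hη : η < 1 / 2)
    (fstar : X → ℝ) (hfstar : fstar ∈ F)
    (hmin : ∀ f ∈ F,
      ∫ x, (1 - Φ (β * fstar x * y x)) ∂p ≤ ∫ x, (1 - Φ (β * f x * y x)) ∂p) :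
    ∀ f ∈ F,
      ∫ x, ((1 - η) * (1 - Φ (β * fstar x * y x)) + η * (1 - Φ (β * fstar x * (-(y x))))) ∂p
        ≤ ∫ x, ((1 - η) * (1 - Φ (β * f x * y x)) + η * (1 - Φ (β * f x * (-(y x))))) ∂p := by
  have hΦcdf : Φ = cdf (gaussianReal 0 1) := by
    ext z
    rw [hΦ, cdf_eq_real, measureReal_def]
  have hΦneg (z : ℝ) : Φ (-z) = 1 - Φ z := by
    simpa only [hΦ, measureReal_def] using gaussianReal_zero_real_Iic_neg one_ne_zero z
  have hΦmeas : Measurable Φ := hΦcdf ▸ (monotone_cdf _).measurable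
  have hint : ∀ f ∈ F, Integrable (fun x ↦ 1 - Φ (β * f x * y x)) p := by
    intro f hf
    have hf' := hF f hf
    refine (integrable_const 1).sub (Integrable.of_bound (C := 1) ?_ (ae_of_all _ fun x ↦ ?_))
    · exact (hΦmeas.comp (by fun_prop)).aestronglyMeasurable
    · rw [hΦcdf, Real.norm_of_nonneg (cdf_nonneg _ _)]
      exact cdf_le_one _ _
  have hrisk : ∀ f ∈ F,
      ∫ x, ((1 - η) * (1 - Φ (β * f x * y x)) + η * (1 - Φ (β * f x * (-(y x))))) ∂p
        = (1 - 2 * η) * ∫ x, (1 - Φ (β * f x * y x)) ∂p + η := by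
    intro f hf
    have hpt (x : X) : (1 - η) * (1 - Φ (β * f x * y x)) + η * (1 - Φ (β * f x * (-(y x))))
        = (1 - 2 * η) * (1 - Φ (β * f x * y x)) + η := by
      rw [mul_neg, hΦneg]
      ring
    simp_rw [hpt]
    rw [integral_add ((hint f hf).const_mul _) (integrable_const _), integral_const_mul]
    simp
  intro f hf
  rw [hrisk fstar hfstar, hrisk f hf]
  have := mul_le_mul_of_nonneg_left (hmin f hf) (by linarith : 0 ≤ 1 - 2 * η)
  linarith
end

section
/- (Theorem 5, non-uniform-noise part.) Let η : X → [0,1] be a measurable noise-rate function with η(x) < 1/2 for p-almost every x. Let f* and f be measurable classifiers such that y(x)·f*(x) > 0 for p-almost every x, and such that the set S₁ = {x : y(x)·f(x) < 0} has p(S₁) > 0. Then there exists β_M < ∞ such that for all β ≥ β_M, the noisy probit risk with parameter β of f* is strictly smaller than that of f: R_{L_probit,β}^η(f*) < R_{L_probit,β}^η(f). -/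
open MeasureTheory ProbabilityTheory
open Filter Topology

/-- The pointwise limit of `z ↦ Φ (β * z)` as `β → ∞`, for a cumulative distribution
function `Φ` with `Φ 0 = c`. -/
noncomputable def stepLimit (c z : ℝ) : ℝ := if z < 0 then 0 else if z = 0 then c else 1

lemma measurable_stepLimit (c : ℝ) : Measurable (stepLimit c) :=
  Measurable.ite measurableSet_Iio measurable_const
    (Measurable.ite (measurableSet_singleton 0) measurable_const measurable_const)

lemma tendsto_cdf_mul_stepLimit (μ : Measure ℝ) (z : ℝ) :
    Tendsto (fun β : ℝ => cdf μ (β * z)) atTop (𝓝 (stepLimit (cdf μ 0) z)) := by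
  unfold stepLimit
  rcases lt_trichotomy z 0 with h | h | h
  · rw [if_pos h]
    exact (tendsto_cdf_atBot μ).comp (tendsto_id.atTop_mul_const_of_neg h)
  · simp [h]
  · rw [if_neg h.not_gt, if_neg h.ne']
    exact (tendsto_cdf_atTop μ).comp (tendsto_id.atTop_mul_const h)

lemma cdf_gaussianReal_zero : cdf (gaussianReal 0 1) 0 = 1 / 2 := by
  have hneg : (gaussianReal 0 1).real (Set.Ici 0) = (gaussianReal 0 1).real (Set.Iic 0) := by
    conv_rhs => rw [← neg_zero (G := ℝ), ← gaussianReal_map_neg]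
    rw [map_measureReal_apply measurable_neg measurableSet_Iic]
    congr 1
    ext x
    simp
  have hna : NullSingletonClass (gaussianReal 0 1) := nullSingletonClass_gaussianReal one_ne_zero
  have hcompl : (gaussianReal 0 1).real (Set.Ioi 0) = 1 - (gaussianReal 0 1).real (Set.Iic 0) := by
    rw [← Set.compl_Iic, probReal_compl_eq_one_sub measurableSet_Iic]
  have hIoi : (gaussianReal 0 1).real (Set.Ioi 0) = (gaussianReal 0 1).real (Set.Ici 0) :=
    measureReal_congr Ioi_ae_eq_Ici
  rw [cdf_eq_real]
  linarith

lemma integral_lt_integral_of_ae_le_of_measure_lt_pos {X : Type*} [MeasurableSpace X]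
    {μ : Measure X} {f g : X → ℝ} (hf : Integrable f μ) (hg : Integrable g μ)
    (hle : f ≤ᵐ[μ] g) (hlt : 0 < μ {x | f x < g x}) : ∫ x, f x ∂μ < ∫ x, g x ∂μ := by
  rw [← sub_pos, ← integral_sub hg hf, integral_pos_iff_support_of_nonneg_ae
    (hle.mono fun x hx => sub_nonneg.2 hx) (hg.sub hf)]
  exact hlt.trans_le (measure_mono fun x hx => (sub_pos.2 hx).ne')

lemma abs_mix_le_one {t a b : ℝ} (ht : 0 ≤ t ∧ t ≤ 1) (ha : 0 ≤ a ∧ a ≤ 1)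
    (hb : 0 ≤ b ∧ b ≤ 1) : |(1 - t) * (1 - a) + t * (1 - b)| ≤ 1 := by
  rw [abs_le]
  constructor <;> nlinarith [mul_nonneg (sub_nonneg.2 ht.2) (sub_nonneg.2 ha.2),
    mul_nonneg ht.1 (sub_nonneg.2 hb.2), mul_nonneg (sub_nonneg.2 ht.2) ha.1,
    mul_nonneg ht.1 hb.1]

lemma stepLimit_mem {c : ℝ} (hc : 0 ≤ c ∧ c ≤ 1) (z : ℝ) :
    0 ≤ stepLimit c z ∧ stepLimit c z ≤ 1 := by
  unfold stepLimit
  split_ifs <;> simp [hc]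

lemma integrable_stepLimit_risk
    {X : Type*} [MeasurableSpace X] (p : Measure X) [IsProbabilityMeasure p]
    {η m : X → ℝ} (hη : Measurable η) (hη01 : ∀ x, 0 ≤ η x ∧ η x ≤ 1) (hm : Measurable m)
    {c : ℝ} (hc : 0 ≤ c ∧ c ≤ 1) :
    Integrable (fun x => (1 - η x) * (1 - stepLimit c (m x))
      + η x * (1 - stepLimit c (-(m x)))) p := by
  have hs := measurable_stepLimit c
  refine Integrable.of_bound (C := 1) (Measurable.aestronglyMeasurable ?_) (ae_of_all _ fun x => ?_)
  · exact ((measurable_const.sub hη).mul (measurable_const.sub (hs.comp hm))).add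
      (hη.mul (measurable_const.sub (hs.comp hm.neg)))
  · exact abs_mix_le_one (hη01 x) (stepLimit_mem hc _) (stepLimit_mem hc _)

lemma tendsto_integral_cdf_risk
    {X : Type*} [MeasurableSpace X] (p : Measure X) [IsProbabilityMeasure p]
    {η m : X → ℝ} (hη : Measurable η) (hη01 : ∀ x, 0 ≤ η x ∧ η x ≤ 1) (hm : Measurable m)
    (μ : Measure ℝ) :
    Tendsto (fun β : ℝ => ∫ x, ((1 - η x) * (1 - cdf μ (β * m x))
      + η x * (1 - cdf μ (β * -(m x)))) ∂p) atTop
      (𝓝 (∫ x, ((1 - η x) * (1 - stepLimit (cdf μ 0) (m x))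
        + η x * (1 - stepLimit (cdf μ 0) (-(m x)))) ∂p)) := by
  have hs : Measurable (cdf μ) := (monotone_cdf μ).measurable
  refine tendsto_integral_filter_of_dominated_convergence (fun _ => 1)
    (Eventually.of_forall fun β => Measurable.aestronglyMeasurable ?_)
    (Eventually.of_forall fun β => ae_of_all _ fun x => ?_) (integrable_const _)
    (ae_of_all _ fun x => ?_)
  · exact ((measurable_const.sub hη).mul
      (measurable_const.sub (hs.comp (measurable_const.mul hm)))).add
      (hη.mul (measurable_const.sub (hs.comp (measurable_const.mul hm.neg))))
  · exact abs_mix_le_one (hη01 x) ⟨cdf_nonneg μ _, cdf_le_one μ _⟩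
      ⟨cdf_nonneg μ _, cdf_le_one μ _⟩
  · exact ((tendsto_cdf_mul_stepLimit μ _).const_sub 1 |>.const_mul _).add
      ((tendsto_cdf_mul_stepLimit μ _).const_sub 1 |>.const_mul _)

/-- Theorem 5 (non-uniform noise): if `η(x) < 1/2` a.e., `f*` separates the classes
(`y(x)·f*(x) > 0` a.e.) and `f` misclassifies a set of positive probability, then there is a
finite `β_M` such that for all `β ≥ β_M` the noisy probit risk of `f*` is strictly smaller
than that of `f` (`Φ` is the standard normal CDF). -/
theorem probit_loss_noise_tolerant_nonuniform
    {X : Type*} [MeasurableSpace X] (p : Measure X) [IsProbabilityMeasure p]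
    (y : X → ℝ) (hy : Measurable y) (hy1 : ∀ x, y x = 1 ∨ y x = -1)
    (Φ : ℝ → ℝ) (hΦ : ∀ z, Φ z = (gaussianReal 0 1 (Set.Iic z)).toReal)
    (η : X → ℝ) (hη : Measurable η) (hη01 : ∀ x, 0 ≤ η x ∧ η x ≤ 1)
    (hηhalf : ∀ᵐ x ∂p, η x < 1 / 2)
    (fstar f : X → ℝ) (hfstar : Measurable fstar) (hf : Measurable f)
    (hsep : ∀ᵐ x ∂p, 0 < y x * fstar x)
    (hS1 : 0 < p {x | y x * f x < 0}) :
    ∃ βM : ℝ, ∀ β ≥ βM,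
      ∫ x, ((1 - η x) * (1 - Φ (β * fstar x * y x))
            + η x * (1 - Φ (β * fstar x * (-(y x))))) ∂p
        < ∫ x, ((1 - η x) * (1 - Φ (β * f x * y x))
            + η x * (1 - Φ (β * f x * (-(y x))))) ∂p := by
  have hΦ' : Φ = cdf (gaussianReal 0 1) := by
    ext z
    rw [hΦ, cdf_eq_real]
    rfl
  subst hΦ'
  have hc : (0 : ℝ) ≤ cdf (gaussianReal 0 1) 0 ∧ cdf (gaussianReal 0 1) 0 ≤ 1 :=
    ⟨cdf_nonneg _ _, cdf_le_one _ _⟩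
  have hmstar := hy.mul hfstar
  have hm := hy.mul hf
  have hlt := integral_lt_integral_of_ae_le_of_measure_lt_pos (μ := p)
    (integrable_stepLimit_risk p hη hη01 hmstar hc) (integrable_stepLimit_risk p hη hη01 hm hc)
    (by
      filter_upwards [hηhalf, hsep] with x hx hs
      rcases lt_trichotomy (y x * f x) 0 with h | h | h
      · simp [stepLimit, hs, hs.not_gt, hs.ne', h, h.not_gt, h.ne]
        linarith
      · simp [stepLimit, hs, hs.not_gt, hs.ne', h, cdf_gaussianReal_zero]
        linarith
      · simp [stepLimit, hs, hs.not_gt, hs.ne', h, h.not_gt, h.ne'])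
    (by
      refine hS1.trans_le (measure_mono_ae ?_)
      filter_upwards [hηhalf, hsep] with x hx hs h
      have h : y x * f x < 0 := h
      change _ < _
      simp [stepLimit, hs, hs.not_gt, hs.ne', h, h.not_gt, h.ne]
      linarith)
  have hev := (tendsto_integral_cdf_risk p hη hη01 hmstar (gaussianReal 0 1)).eventually_lt
    (tendsto_integral_cdf_risk p hη hη01 hm (gaussianReal 0 1)) hlt
  obtain ⟨βM, hβ⟩ := eventually_atTop.1 hev
  refine ⟨βM, fun β h => ?_⟩
  have hmul : ∀ (g : X → ℝ) x, β * g x * y x = β * (y x * g x) := fun g x => by ring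
  simpa only [mul_neg, hmul, Pi.mul_apply] using hβ β h
end

section
/- (Class-conditional risk identity.) Let L satisfy the symmetry condition with constant K > 0 and assume x ↦ L(f(x), 1) and x ↦ L(f(x), −1) are measurable for every f ∈ F. Let η₁, η₂ ∈ [0,1) with η₁ + η₂ < 1, set k = (1 − η₁ + η₂)/(1 − η₂ + η₁), and define the loss l by l(t,1) = L(t,1) and l(t,−1) = k·L(t,−1). Let C₊ = {x : y(x) = 1} and C₋ = {x : y(x) = −1}, and let the class-conditional noisy l-risk of f be R_l^η(f) = ∫_{C₊} [(1−η₁)·l(f(x),1) + η₁·l(f(x),−1)] dp(x) + ∫_{C₋} [(1−η₂)·l(f(x),−1) + η₂·l(f(x),1)] dp(x). Then for every f ∈ F, R_l^η(f) = ((1 − η₁ − η₂)/(1 − η₂ + η₁))·R_L(f) + K·(η₁·k·p(C₊) + η₂·p(C₋)). -/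
open MeasureTheory

/-- Class-conditional risk identity: with `L` symmetric with constant `K > 0`, noise rates
`η₁, η₂` with `η₁ + η₂ < 1`, `k = (1 - η₁ + η₂)/(1 - η₂ + η₁)` and the modified loss
`l(t,1) = L(t,1)`, `l(t,-1) = k·L(t,-1)`, the class-conditional noisy `l`-risk of any `f ∈ F`
equals `((1 - η₁ - η₂)/(1 - η₂ + η₁))·R_L(f) + K·(η₁·k·p(C₊) + η₂·p(C₋))`. -/
theorem class_conditional_risk_identity
    {X : Type*} [MeasurableSpace X] (p : Measure X) [IsProbabilityMeasure p]
    (y : X → ℝ) (hy : Measurable y) (hy1 : ∀ x, y x = 1 ∨ y x = -1)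
    (L : ℝ → ℝ → ℝ) (hL : ∀ t u, 0 ≤ L t u)
    (K : ℝ) (hK : 0 < K) (hsym : ∀ t, L t 1 + L t (-1) = K)
    (F : Set (X → ℝ)) (hF : ∀ f ∈ F, Measurable f)
    (hmeas₁ : ∀ f ∈ F, Measurable (fun x => L (f x) 1))
    (hmeas₂ : ∀ f ∈ F, Measurable (fun x => L (f x) (-1)))
    (η₁ η₂ : ℝ) (hη₁ : 0 ≤ η₁) (hη₁' : η₁ < 1) (hη₂ : 0 ≤ η₂) (hη₂' : η₂ < 1)
    (hsum : η₁ + η₂ < 1)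
    (k : ℝ) (hk : k = (1 - η₁ + η₂) / (1 - η₂ + η₁)) :
    ∀ f ∈ F,
      (∫ x in {x | y x = 1}, ((1 - η₁) * L (f x) 1 + η₁ * (k * L (f x) (-1))) ∂p)
        + (∫ x in {x | y x = -1}, ((1 - η₂) * (k * L (f x) (-1)) + η₂ * L (f x) 1) ∂p)
      = ((1 - η₁ - η₂) / (1 - η₂ + η₁)) * (∫ x, L (f x) (y x) ∂p)
        + K * (η₁ * k * (p {x | y x = 1}).toReal + η₂ * (p {x | y x = -1}).toReal) := by
  intro f hf
  have hD : 1 - η₂ + η₁ ≠ 0 := by linarith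
  have hpos : 1 - η₁ - η₁ * k = (1 - η₁ - η₂) / (1 - η₂ + η₁) := by
    rw [hk]; field_simp; ring
  have hneg : (1 - η₂) * k - η₂ = (1 - η₁ - η₂) / (1 - η₂ + η₁) := by
    rw [hk]; field_simp; ring
  set c := (1 - η₁ - η₂) / (1 - η₂ + η₁)
  have hS : MeasurableSet {x | y x = 1} := hy (measurableSet_singleton 1)
  have hT : MeasurableSet {x | y x = -1} := hy (measurableSet_singleton (-1))
  have hcompl : {x | y x = 1}ᶜ = {x | y x = -1} := by
    ext x
    rcases hy1 x with h | h <;> simp [h] <;> norm_num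
  have hint : Integrable (fun x => L (f x) (y x)) p := by
    refine Integrable.of_bound (C := K) ?_ (ae_of_all _ fun x => ?_)
    · have heq : (fun x => L (f x) (y x))
          = {x | y x = 1}.indicator (fun x => L (f x) 1)
            + {x | y x = -1}.indicator (fun x => L (f x) (-1)) := by
        ext x
        rcases hy1 x with h | h <;> simp [Set.indicator, h] <;> norm_num
      rw [heq]
      exact (((hmeas₁ f hf).indicator hS).add ((hmeas₂ f hf).indicator hT)).aestronglyMeasurable
    · rw [Real.norm_of_nonneg (hL _ _)]
      have h1 := hL (f x) 1
      have h2 := hL (f x) (-1)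
      have h3 := hsym (f x)
      rcases hy1 x with h | h <;> rw [h] <;> linarith
  have hplus : ∫ x in {x | y x = 1}, ((1 - η₁) * L (f x) 1 + η₁ * (k * L (f x) (-1))) ∂p
      = c * (∫ x in {x | y x = 1}, L (f x) (y x) ∂p)
        + (p {x | y x = 1}).toReal * (η₁ * k * K) := by
    rw [setIntegral_congr_fun (g := fun x => c * L (f x) (y x) + η₁ * k * K) hS fun x hx => ?_,
      integral_add (hint.integrableOn.const_mul c) (integrable_const _), integral_const_mul,
      setIntegral_const, smul_eq_mul, measureReal_def]
    simp only [Set.mem_ofPred_eq] at hx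
    simp only [hx, ← hpos, ← hsym (f x)]
    ring
  have hminus : ∫ x in {x | y x = -1}, ((1 - η₂) * (k * L (f x) (-1)) + η₂ * L (f x) 1) ∂p
      = c * (∫ x in {x | y x = -1}, L (f x) (y x) ∂p)
        + (p {x | y x = -1}).toReal * (η₂ * K) := by
    rw [setIntegral_congr_fun (g := fun x => c * L (f x) (y x) + η₂ * K) hT fun x hx => ?_,
      integral_add (hint.integrableOn.const_mul c) (integrable_const _), integral_const_mul,
      setIntegral_const, smul_eq_mul, measureReal_def]
    simp only [Set.mem_ofPred_eq] at hx
    simp only [hx, ← hneg, ← hsym (f x)]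
    ring
  rw [hplus, hminus, ← integral_add_compl hS hint, hcompl]
  ring
end

section
/- (Theorem 2.) Let L satisfy the symmetry condition with constant K > 0 and assume x ↦ L(f(x), 1) and x ↦ L(f(x), −1) are measurable for every f ∈ F. Let η₁, η₂ ∈ [0,1) with η₁ + η₂ < 1, set k = (1 − η₁ + η₂)/(1 − η₂ + η₁), and define the loss l by l(t,1) = L(t,1) and l(t,−1) = k·L(t,−1). Let the class-conditional noisy l-risk of f be R_l^η(f) = ∫_{C₊} [(1−η₁)·l(f(x),1) + η₁·l(f(x),−1)] dp(x) + ∫_{C₋} [(1−η₂)·l(f(x),−1) + η₂·l(f(x),1)] dp(x), where C₊ = {x : y(x)=1} and C₋ = {x : y(x)=−1}. If f* ∈ F is a global minimizer of the noise-free L-risk R_L over F, then f* is also a global minimizer of R_l^η over F; i.e., R_l^η(f*) ≤ R_l^η(f) for all f ∈ F. -/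
open MeasureTheory

/-- For labels in `{1, -1}`, integrating `c * L (f x) (y x)` plus a constant depending only on
the class gives `c` times the risk of `f` plus a constant independent of `f`. -/
theorem setIntegral_affine_add_setIntegral_affine
    {X : Type*} [MeasurableSpace X] (p : Measure X) [IsFiniteMeasure p]
    {y : X → ℝ} (hy : Measurable y) (hy1 : ∀ x, y x = 1 ∨ y x = -1)
    {L : ℝ → ℝ → ℝ} {f : X → ℝ} (h₁ : Integrable (fun x => L (f x) 1) p)
    (h₂ : Integrable (fun x => L (f x) (-1)) p) (a b c : ℝ) :
    (∫ x in {x | y x = 1}, (c * L (f x) 1 + a) ∂p)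
      + (∫ x in {x | y x = -1}, (c * L (f x) (-1) + b) ∂p)
      = c * (∫ x, L (f x) (y x) ∂p)
        + (p.real {x | y x = 1} * a + p.real {x | y x = -1} * b) := by
  have hpos : MeasurableSet {x | y x = 1} := hy (measurableSet_singleton 1)
  have hneg : MeasurableSet {x | y x = -1} := hy (measurableSet_singleton (-1))
  have hcompl : {x | y x = 1}ᶜ = {x | y x = -1} := by
    ext x
    rcases hy1 x with h | h <;> simp [h] <;> norm_num
  have e₁ : ∫ x in {x | y x = 1}, L (f x) (y x) ∂p = ∫ x in {x | y x = 1}, L (f x) 1 ∂p :=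
    setIntegral_congr_fun hpos fun x (hx : y x = 1) => by simp only [hx]
  have e₂ : ∫ x in {x | y x = -1}, L (f x) (y x) ∂p = ∫ x in {x | y x = -1}, L (f x) (-1) ∂p :=
    setIntegral_congr_fun hneg fun x (hx : y x = -1) => by simp only [hx]
  have i₁ : IntegrableOn (fun x => L (f x) (y x)) {x | y x = 1} p :=
    (integrableOn_congr_fun (fun x (hx : y x = 1) => by simp only [hx]) hpos).2 h₁.integrableOn
  have i₂ : IntegrableOn (fun x => L (f x) (y x)) {x | y x = -1} p :=
    (integrableOn_congr_fun (fun x (hx : y x = -1) => by simp only [hx]) hneg).2 h₂.integrableOn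
  have hint : Integrable (fun x => L (f x) (y x)) p := by
    rw [← integrableOn_univ, ← Set.union_compl_self {x | y x = 1}, hcompl]
    exact i₁.union i₂
  rw [← integral_add_compl hpos hint, hcompl, e₁, e₂,
    integral_add (h₁.integrableOn.const_mul c) (integrable_const a),
    integral_add (h₂.integrableOn.const_mul c) (integrable_const b),
    integral_const_mul, integral_const_mul, setIntegral_const, setIntegral_const]
  simp only [smul_eq_mul]
  ring

/-- Theorem 2: with `L` symmetric with constant `K > 0`, class-conditional noise rates
`η₁, η₂` with `η₁ + η₂ < 1`, `k = (1 - η₁ + η₂)/(1 - η₂ + η₁)` and the modified loss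
`l(t,1) = L(t,1)`, `l(t,-1) = k·L(t,-1)`, any global minimizer `f*` of the noise-free `L`-risk
over `F` is also a global minimizer over `F` of the class-conditional noisy `l`-risk. -/
theorem class_conditional_noise_tolerance
    {X : Type*} [MeasurableSpace X] (p : Measure X) [IsProbabilityMeasure p]
    (y : X → ℝ) (hy : Measurable y) (hy1 : ∀ x, y x = 1 ∨ y x = -1)
    (L : ℝ → ℝ → ℝ) (hL : ∀ t u, 0 ≤ L t u)
    (K : ℝ) (hK : 0 < K) (hsym : ∀ t, L t 1 + L t (-1) = K)
    (F : Set (X → ℝ)) (hF : ∀ f ∈ F, Measurable f)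
    (hmeas₁ : ∀ f ∈ F, Measurable (fun x => L (f x) 1))
    (hmeas₂ : ∀ f ∈ F, Measurable (fun x => L (f x) (-1)))
    (η₁ η₂ : ℝ) (hη₁ : 0 ≤ η₁) (hη₁' : η₁ < 1) (hη₂ : 0 ≤ η₂) (hη₂' : η₂ < 1)
    (hsum : η₁ + η₂ < 1)
    (k : ℝ) (hk : k = (1 - η₁ + η₂) / (1 - η₂ + η₁))
    (fstar : X → ℝ) (hfstar : fstar ∈ F)
    (hmin : ∀ f ∈ F, ∫ x, L (fstar x) (y x) ∂p ≤ ∫ x, L (f x) (y x) ∂p) :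
    ∀ f ∈ F,
      (∫ x in {x | y x = 1}, ((1 - η₁) * L (fstar x) 1 + η₁ * (k * L (fstar x) (-1))) ∂p)
        + (∫ x in {x | y x = -1}, ((1 - η₂) * (k * L (fstar x) (-1)) + η₂ * L (fstar x) 1) ∂p)
      ≤ (∫ x in {x | y x = 1}, ((1 - η₁) * L (f x) 1 + η₁ * (k * L (f x) (-1))) ∂p)
        + (∫ x in {x | y x = -1}, ((1 - η₂) * (k * L (f x) (-1)) + η₂ * L (f x) 1) ∂p) := by
  have hd : 0 < 1 - η₂ + η₁ := by linarith
  have hkd : k * (1 - η₂ + η₁) = 1 - η₁ + η₂ := by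
    rw [hk, div_mul_cancel₀ _ hd.ne']
  have hc : 0 ≤ 1 - η₁ - η₁ * k := by
    have h : (1 - η₁ - η₁ * k) * (1 - η₂ + η₁) = 1 - η₁ - η₂ := by
      linear_combination (-η₁) * hkd
    exact (pos_of_mul_pos_left (by rw [h]; linarith) hd.le).le
  have hrisk : ∀ f ∈ F,
      (∫ x in {x | y x = 1}, ((1 - η₁) * L (f x) 1 + η₁ * (k * L (f x) (-1))) ∂p)
        + (∫ x in {x | y x = -1}, ((1 - η₂) * (k * L (f x) (-1)) + η₂ * L (f x) 1) ∂p)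
      = (1 - η₁ - η₁ * k) * (∫ x, L (f x) (y x) ∂p)
        + (p.real {x | y x = 1} * (η₁ * k * K) + p.real {x | y x = -1} * (η₂ * K)) := by
    intro f hf
    have i₁ : Integrable (fun x => L (f x) 1) p :=
      Integrable.of_mem_Icc 0 K (hmeas₁ f hf).aemeasurable <| .of_forall fun x =>
        ⟨hL _ _, by linarith [hsym (f x), hL (f x) (-1)]⟩
    have i₂ : Integrable (fun x => L (f x) (-1)) p :=
      Integrable.of_mem_Icc 0 K (hmeas₂ f hf).aemeasurable <| .of_forall fun x =>
        ⟨hL _ _, by linarith [hsym (f x), hL (f x) 1]⟩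
    rw [← setIntegral_affine_add_setIntegral_affine p hy hy1 i₁ i₂]
    congr 2
    · funext x
      linear_combination (η₁ * k) * hsym (f x)
    · funext x
      linear_combination η₂ * hsym (f x) + L (f x) (-1) * hkd
  intro f hf
  rw [hrisk fstar hfstar, hrisk f hf]
  exact add_le_add_left (mul_le_mul_of_nonneg_left (hmin f hf) hc) _
end
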